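/- For n ≥ 4, there exists a non-TTC mechanism on the circular domain D^C that is individually rational, Pareto efficient, and strategyproof. -/

import Mathlib

def top {α : Type*} (P : α → α → Prop) (O' : Set α) (a : α) : Prop :=
  a ∈ O' ∧ ∀ c ∈ O', c ≠ a → P a c

def topTwo {α : Type*} (D : Set (α → α → Prop)) : Prop :=
  ∀ O' : Set α, O'.Nonempty → ∀ a b : α, a ∈ O' → b ∈ O' → a ≠ b →
    (∃ P ∈ D, top P O' a) → (∃ P ∈ D, top P O' b) →
      ∃ P0 ∈ D, top P0 O' a ∧ top P0 (O' \ {a}) b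

/-! Housing market: agents and objects are both `Fin n`; agent i is endowed with
object i. A preference is a strict linear order on objects, modelled as a binary
relation (`P a b` means a is strictly preferred to b). -/

abbrev PrefRel (n : ℕ) := Fin n → Fin n → Prop

/-- A preference profile where agent i's preference must lie in the domain `Ds i`. -/
def Profile (n : ℕ) (Ds : Fin n → Set (PrefRel n)) : Type := {Pr : Fin n → PrefRel n // ∀ i, Pr i ∈ Ds i}

/-- Individual rationality: every agent weakly prefers their assignment to their endowment. -/
def IR {n : ℕ} {Ds : Fin n → Set (PrefRel n)} (φ : Profile n Ds → Fin n → Fin n) : Prop :=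
  ∀ P : Profile n Ds, ∀ i : Fin n, φ P i = i ∨ P.1 i (φ P i) i

/-- Strategyproofness: truth-telling is weakly dominant within the domain. -/
def SP {n : ℕ} {Ds : Fin n → Set (PrefRel n)} (φ : Profile n Ds → Fin n → Fin n) : Prop :=
  ∀ P Q : Profile n Ds, ∀ i : Fin n, (∀ j, j ≠ i → Q.1 j = P.1 j) →
    φ P i = φ Q i ∨ P.1 i (φ P i) (φ Q i)

/-- Pair efficiency: no two agents each strictly prefer the other's assignment. -/
def PairEff {n : ℕ} {Ds : Fin n → Set (PrefRel n)} (φ : Profile n Ds → Fin n → Fin n) : Prop :=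
  ∀ P : Profile n Ds, ∀ i j : Fin n, ¬ (P.1 i (φ P j) (φ P i) ∧ P.1 j (φ P i) (φ P j))

/-- Pareto efficiency: any allocation that weakly improves upon φ(P) for every agent
coincides with φ(P). -/
def ParetoEff {n : ℕ} {Ds : Fin n → Set (PrefRel n)} (φ : Profile n Ds → Fin n → Fin n) : Prop :=
  ∀ P : Profile n Ds, ∀ y : Fin n → Fin n, Function.Bijective y →
    (∀ i, y i = φ P i ∨ P.1 i (y i) (φ P i)) → ∀ i, y i = φ P i

/-- `x` is the Top Trading Cycles allocation at the profile `Pr`: there is an assignment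
of rounds `r` to agents (= objects, via endowment) such that each agent i receives their
most preferred object among objects whose owner is removed no earlier than i, and the
owner of the object i receives is removed in the same round as i. -/
def isTTC {n : ℕ} (Pr : Fin n → PrefRel n) (x : Fin n → Fin n) : Prop :=
  Function.Bijective x ∧ ∃ r : Fin n → ℕ, ∀ i : Fin n,
    r (x i) = r i ∧ ∀ o : Fin n, r i ≤ r o → o ≠ x i → Pr i (x i) o

/-- Clockwise circular preference with peak p: o_p ≻ o_{p+1} ≻ ... (indices mod n). -/
def cw {n : ℕ} (p : Fin n) : Fin n → Fin n → Prop := fun a b => (a - p).val < (b - p).val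

/-- Counterclockwise circular preference with peak p: o_p ≻ o_{p-1} ≻ ... (indices mod n). -/
def ccw {n : ℕ} (p : Fin n) : Fin n → Fin n → Prop := fun a b => (p - a).val < (p - b).val

/-- The circular domain w.r.t. the cyclic order o1 → o2 → ... → on → o1. -/
def circDomain (n : ℕ) : Set (Fin n → Fin n → Prop) := {P | ∃ p : Fin n, P = cw p ∨ P = ccw p}

section TopTradingCycles

variable {n : ℕ} {Pr Qr : Fin n → PrefRel n} {x y : Fin n → Fin n}

theorem exists_top_of_nonempty {α : Type*} [Finite α] (R : α → α → Prop) [IsStrictTotalOrder α R]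
    {S : Set α} (hS : S.Nonempty) : ∃ m, top R S m := by
  obtain ⟨m, hm, hmin⟩ := (Finite.wellFounded_of_trans_of_irrefl R).has_min S hS
  refine ⟨m, hm, fun c hc hcm => ?_⟩
  rcases trichotomous_of R m c with h | h | h
  · exact h
  · exact absurd h.symm hcm
  · exact absurd h (hmin c hc)

/-- Top trading cycles on a submarket `S`: all cycles of the top-choice map are executed, and the
rest of the market is treated recursively. -/
theorem exists_ttc_on (hPr : ∀ i, IsStrictTotalOrder (Fin n) (Pr i)) (S : Finset (Fin n)) :
    ∃ x : Fin n → Fin n, ∃ r : Fin n → ℕ, Set.BijOn x S S ∧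
      ∀ i ∈ S, r (x i) = r i ∧ ∀ o ∈ S, r i ≤ r o → o ≠ x i → Pr i (x i) o := by
  classical
  induction S using Finset.strongInduction with
  | H S ih =>
    rcases S.eq_empty_or_nonempty with rfl | hS
    · exact ⟨id, fun _ => 0, by simp, by simp⟩
    choose t htS htop using fun i => exists_top_of_nonempty (Pr i) (S := (S : Set (Fin n))) hS
    obtain ⟨s₀, hs₀⟩ := hS
    have hper : ∀ i ∈ Function.periodicPts t, i ∈ S := by
      intro i hi
      obtain ⟨j, -, rfl⟩ := (Function.bijOn_periodicPts t).surjOn hi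
      exact htS j
    have hne : ∃ i, i ∈ Function.periodicPts t := by
      obtain ⟨k, l, hkl, h⟩ := Finite.exists_ne_map_eq_of_infinite fun k : ℕ => t^[k] s₀
      wlog hlt : k < l generalizing k l
      · exact this l k hkl.symm h.symm (by omega)
      refine ⟨t^[k] s₀, Function.mk_mem_periodicPts (n := l - k) (by omega) ?_⟩
      change t^[l - k] (t^[k] s₀) = _
      rw [← Function.iterate_add_apply, Nat.sub_add_cancel hlt.le]
      exact h.symm
    obtain ⟨p, hp⟩ := hne
    obtain ⟨x, r, hx, hr⟩ := ih (S.filter (· ∉ Function.periodicPts t))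
      (Finset.filter_ssubset.2 ⟨p, hper p hp, by simpa using hp⟩)
    have hxS : ∀ i ∈ S, i ∉ Function.periodicPts t → x i ∈ S ∧ x i ∉ Function.periodicPts t := by
      intro i hi hi'
      simpa using hx.mapsTo (show i ∈ _ by simp [hi, hi'])
    have htp : ∀ i ∈ Function.periodicPts t, t i ∈ Function.periodicPts t :=
      fun i hi => (Function.bijOn_periodicPts t).mapsTo hi
    refine ⟨fun i => if i ∈ Function.periodicPts t then t i else x i,
      fun i => if i ∈ Function.periodicPts t then 0 else r i + 1, ⟨?_, ?_, ?_⟩, ?_⟩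
    · intro i hi
      by_cases h : i ∈ Function.periodicPts t
      · simpa [h] using htS i
      · simpa [h] using (hxS i hi h).1
    · intro i hi j hj hij
      by_cases h : i ∈ Function.periodicPts t <;> by_cases h' : j ∈ Function.periodicPts t <;>
        simp only [h, h', if_true, if_false] at hij
      · exact (Function.bijOn_periodicPts t).injOn h h' hij
      · exact absurd (hij ▸ htp i h) (hxS j hj h').2
      · exact absurd (hij ▸ htp j h') (hxS i hi h).2
      · refine hx.injOn ?_ ?_ hij
        · simpa [h] using hi
        · simpa [h'] using hj
    · intro j hj
      by_cases h : j ∈ Function.periodicPts t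
      · obtain ⟨i, hi, rfl⟩ := (Function.bijOn_periodicPts t).surjOn h
        exact ⟨i, hper i hi, by simp [hi]⟩
      · obtain ⟨i, hi, rfl⟩ := hx.surjOn (show j ∈ _ by simpa [h] using hj)
        simp only [Finset.coe_filter, Set.mem_ofPred_eq] at hi
        exact ⟨i, hi.1, by simp [hi.2]⟩
    · intro i hi
      by_cases h : i ∈ Function.periodicPts t
      · simp only [h, htp i h, if_true, true_and]
        exact fun o ho _ hoi => htop i o ho hoi
      · simp only [h, (hxS i hi h).2, if_false]
        have := hr i (by simp [hi, h])
        refine ⟨by rw [this.1], fun o ho hro hoi => ?_⟩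
        by_cases h' : o ∈ Function.periodicPts t
        · simp [h'] at hro
        · exact this.2 o (by simp [ho, h']) (by simpa [h'] using hro) hoi

theorem exists_isTTC (hPr : ∀ i, IsStrictTotalOrder (Fin n) (Pr i)) : ∃ x, isTTC Pr x := by
  obtain ⟨x, r, hx, hr⟩ := exists_ttc_on hPr Finset.univ
  refine ⟨x, ?_, r, fun i => ?_⟩
  · simpa [Set.bijOn_univ] using hx
  · simpa using hr i (Finset.mem_univ i)

theorem isTTC.individuallyRational (hx : isTTC Pr x) (i : Fin n) : x i = i ∨ Pr i (x i) i := by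
  obtain ⟨-, r, hr⟩ := hx
  by_cases h : x i = i
  · exact Or.inl h
  · exact Or.inr ((hr i).2 i le_rfl (Ne.symm h))

theorem isTTC.eq_of_weakly_improves (hPr : ∀ i, IsStrictTotalOrder (Fin n) (Pr i))
    (hx : isTTC Pr x) (hy : Function.Bijective y) (himp : ∀ i, y i = x i ∨ Pr i (y i) (x i))
    (i : Fin n) : y i = x i := by
  obtain ⟨hbij, r, hr⟩ := hx
  induction hk : r i using Nat.strong_induction_on generalizing i with
  | _ k ih =>
    subst hk
    by_contra hne
    have hpref := (himp i).resolve_left hne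
    by_cases hle : r i ≤ r (y i)
    · exact asymm_of (Pr i) hpref ((hr i).2 _ hle hne)
    · obtain ⟨j, hj⟩ := hbij.surjective (y i)
      have hrj : r j = r (y i) := by rw [← (hr j).1, hj]
      have := ih (r j) (by omega) j rfl
      rw [hj] at this
      rw [hy.injective this] at hrj
      omega

theorem mem_of_injective_of_mapsTo {α : Type*} [Finite α] {f : α → α} (hf : Function.Injective f)
    {D : Set α} (hD : Set.MapsTo f D D) {a : α} (ha : f a ∈ D) : a ∈ D := by
  obtain ⟨b, hb, hab⟩ := (Set.map_eq_of_subset (f := ⟨f, hf⟩) hD.image_subset).symm ▸ ha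
  exact hf hab ▸ hb

/-- The trades executed before agent `i` is removed do not depend on the report of `i`. -/
theorem eq_of_round_lt (hPr : ∀ i, IsStrictTotalOrder (Fin n) (Pr i)) (i : Fin n)
    (hQ : ∀ j, j ≠ i → Qr j = Pr j) (hy : isTTC Qr y) (hx : Function.Bijective x) {r : Fin n → ℕ}
    (hr : ∀ i : Fin n, r (x i) = r i ∧ ∀ o : Fin n, r i ≤ r o → o ≠ x i → Pr i (x i) o)
    (j : Fin n) (hj : r j < r i) : y j = x j := by
  obtain ⟨hybij, s, hs⟩ := hy
  induction hk : r j using Nat.strong_induction_on generalizing j with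
  | _ k ih =>
    subst hk
    induction hl : s j using Nat.strong_induction_on generalizing j with
    | _ l ihs =>
      subst hl
      have hround : r j ≤ r (y j) := by
        by_contra hlt
        obtain ⟨m, hm⟩ := hx.surjective (y j)
        have hrm : r m = r (y j) := by rw [← (hr m).1, hm]
        have := ih (r m) (by omega) m (by omega) rfl
        rw [hm] at this
        rw [hybij.injective this] at hrm
        omega
      have hround' : s j ≤ s (x j) := by
        by_contra hlt
        have hmaps : Set.MapsTo x {m | r m = r j ∧ s m < s j} {m | r m = r j ∧ s m < s j} := by
          rintro m ⟨hm, hm'⟩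
          have hym : y m = x m :=
            ihs (s m) hm' m (by omega) (fun k hk => ih k (by omega)) rfl
          exact ⟨by rw [(hr m).1, hm], by rw [← hym, (hs m).1]; exact hm'⟩
        have := mem_of_injective_of_mapsTo hx.injective hmaps
          (show x j ∈ _ from ⟨(hr j).1, by omega⟩)
        exact lt_irrefl _ this.2
      by_contra hne
      have h₁ := (hr j).2 _ hround hne
      have h₂ := (hs j).2 _ hround' (Ne.symm hne)
      rw [hQ j (by rintro rfl; omega)] at h₂
      exact asymm_of (Pr j) h₁ h₂

theorem isTTC.strategyproof (hPr : ∀ i, IsStrictTotalOrder (Fin n) (Pr i)) {i : Fin n}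
    (hQ : ∀ j, j ≠ i → Qr j = Pr j) (hx : isTTC Pr x) (hy : isTTC Qr y) :
    x i = y i ∨ Pr i (x i) (y i) := by
  obtain ⟨hxbij, r, hr⟩ := hx
  by_cases hne : x i = y i
  · exact Or.inl hne
  refine Or.inr ((hr i).2 _ ?_ (Ne.symm hne))
  by_contra hlt
  obtain ⟨j, hj⟩ := hxbij.surjective (y i)
  have hrj : r j = r (y i) := by rw [← (hr j).1, hj]
  have := eq_of_round_lt hPr i hQ hy hxbij hr j (by omega)
  rw [hj] at this
  rw [hy.1.injective this] at hrj
  omega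

end TopTradingCycles

section Circular

variable {n : ℕ}

theorem isStrictTotalOrder_of_injective {α : Type*} {f : α → ℕ} (hf : Function.Injective f) :
    IsStrictTotalOrder α fun a b => f a < f b where
  trichotomous _ _ h h' := hf (le_antisymm (not_lt.1 h') (not_lt.1 h))
  irrefl _ := lt_irrefl _
  trans _ _ _ := lt_trans

theorem isStrictTotalOrder_of_mem_circDomain [NeZero n] {P : PrefRel n} (hP : P ∈ circDomain n) :
    IsStrictTotalOrder (Fin n) P := by
  obtain ⟨p, rfl | rfl⟩ := hP
  · exact isStrictTotalOrder_of_injective (f := fun a => (a - p).val)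
      fun _ _ h => sub_left_injective (Fin.ext h)
  · exact isStrictTotalOrder_of_injective (f := fun a => (p - a).val)
      fun _ _ h => sub_right_injective (Fin.ext h)

/-- `P` ranks `a`, `b`, `c`, `d` in this order. -/
def Ranks {α : Type*} (P : α → α → Prop) (a b c d : α) : Prop :=
  P a b ∧ P b c ∧ P c d

/-- `P` ranks the four objects as some circular preference for the order `a → b → c → d → a`. -/
def CircularOn {α : Type*} (P : α → α → Prop) (a b c d : α) : Prop :=
  (Ranks P a b c d ∨ Ranks P b c d a ∨ Ranks P c d a b ∨ Ranks P d a b c) ∨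
    Ranks P a d c b ∨ Ranks P b a d c ∨ Ranks P c b a d ∨ Ranks P d c b a

theorem val_sub_eq_ite (a p : Fin n) :
    (a - p).val = if p.val ≤ a.val then a.val - p.val else n + a.val - p.val := by
  split_ifs with h
  · exact Fin.coe_sub_iff_le.2 h
  · exact Fin.coe_sub_iff_lt.2 (not_le.1 h)

theorem circularOn_of_mem_circDomain [NeZero n] {P : PrefRel n} (hP : P ∈ circDomain n)
    {a b c d : Fin n} (hab : a < b) (hbc : b < c) (hcd : c < d) : CircularOn P a b c d := by
  obtain ⟨p, rfl | rfl⟩ := hP <;>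
    simp only [CircularOn, Ranks, cw, ccw, val_sub_eq_ite] <;> simp only [Fin.lt_def] at * <;>
    split_ifs <;> omega

end Circular

section Mechanism

variable {n : ℕ} {Pr Qr : Fin n → PrefRel n} {x : Fin n → Fin n} {a b c d : Fin n}

/-- `r` are rounds of top trading cycles leading to `x` within the submarket `M`. -/
def RoundsOn (Pr : Fin n → PrefRel n) (M : Set (Fin n)) (x : Fin n → Fin n) (r : Fin n → ℕ) :
    Prop :=
  ∀ i ∈ M, x i ∈ M ∧ r (x i) = r i ∧ ∀ o ∈ M, r i ≤ r o → o ≠ x i → Pr i (x i) o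

theorem isTTC.exists_roundsOn (hPr : ∀ i, IsStrictTotalOrder (Fin n) (Pr i)) (hx : isTTC Pr x)
    {M : Set (Fin n)} (hM : ∀ k ∉ M, top (Pr k) Set.univ k) : ∃ r, RoundsOn Pr M x r := by
  have hfix : ∀ k ∉ M, x k = k := fun k hk => by
    by_contra hne
    exact asymm_of (Pr k) ((hM k hk).2 _ (Set.mem_univ _) hne)
      ((hx.individuallyRational k).resolve_left hne)
  obtain ⟨hbij, r, hr⟩ := hx
  refine ⟨r, fun i hi => ⟨?_, (hr i).1, fun o _ => (hr i).2 o⟩⟩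
  by_contra hxi
  have := hbij.injective (hfix _ hxi)
  rw [this] at hxi
  exact hxi hi

theorem RoundsOn.eq_of_top {M : Set (Fin n)} (hPr : ∀ i, IsStrictTotalOrder (Fin n) (Pr i))
    {r : Fin n → ℕ} (hr : RoundsOn Pr M x r) {i t : Fin n} (hi : i ∈ M) (ht : top (Pr i) M t)
    (hle : r i ≤ r t) : x i = t ∧ r t = r i := by
  have h : x i = t := by
    by_contra hne
    exact asymm_of (Pr i) (ht.2 _ (hr i hi).1 hne) ((hr i hi).2.2 t ht.1 hle (Ne.symm hne))
  exact ⟨h, h ▸ (hr i hi).2.1⟩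

theorem RoundsOn.le_of_top {M : Set (Fin n)} (hPr : ∀ i, IsStrictTotalOrder (Fin n) (Pr i))
    {r : Fin n → ℕ} (hr : RoundsOn Pr M x r) {i t : Fin n} (hi : i ∈ M) (ht : top (Pr i) M t) :
    r t ≤ r i := by
  by_contra hlt
  have := (hr.eq_of_top hPr hi ht (by omega)).2
  omega

theorem RoundsOn.swap_of_top {M : Set (Fin n)} (hPr : ∀ i, IsStrictTotalOrder (Fin n) (Pr i))
    {r : Fin n → ℕ} (hr : RoundsOn Pr M x r) {i j : Fin n} (hi : top (Pr i) M j)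
    (hj : top (Pr j) M i) : x i = j ∧ x j = i :=
  ⟨(hr.eq_of_top hPr hj.1 hi (hr.le_of_top hPr hi.1 hj)).1,
    (hr.eq_of_top hPr hi.1 hj (hr.le_of_top hPr hj.1 hi)).1⟩

/-- If `c` prefers `a` to staying put, an agent leaving no later than `a`, `b` and `d` also leaves
no later than `c`, and so gets their top choice. -/
theorem RoundsOn.eq_top_of_round_le (hPr : ∀ i, IsStrictTotalOrder (Fin n) (Pr i))
    {r : Fin n → ℕ} (hr : RoundsOn Pr {a, b, c, d} x r) (hc : Pr c a c) {i t : Fin n}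
    (hi : i ∈ ({a, b, c, d} : Set (Fin n))) (ht : top (Pr i) {a, b, c, d} t)
    (hia : r i ≤ r a) (hib : r i ≤ r b) (hid : r i ≤ r d) : x i = t := by
  have hic : r i ≤ r c := by
    by_contra hlt
    obtain ⟨hmem, hxc, hpref⟩ := hr c (by simp)
    have hac : a ≠ c := by
      rintro rfl
      exact irrefl_of (Pr a) a hc
    rcases hmem with h | h | h | h <;> rw [h] at hxc
    · omega
    · omega
    · have := hpref a (by simp) (by omega) (h.symm ▸ hac)
      rw [h] at this
      exact asymm_of (Pr c) hc this
    · have : x c = d := h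
      omega
  refine (hr.eq_of_top hPr hi ht ?_).1
  rcases ht.1 with rfl | rfl | rfl | rfl <;> assumption

/-- The profiles at which the mechanism below departs from top trading cycles. -/
structure Exceptional (Pr : Fin n → PrefRel n) (a b c d : Fin n) : Prop where
  top_a : top (Pr a) {a, b, c, d} b
  top_b : top (Pr b) {a, b, c, d} d
  pref_c : Pr c a c
  top_d : top (Pr d) {a, b, c, d} b
  top_self : ∀ k ∉ ({a, b, c, d} : Set (Fin n)), top (Pr k) Set.univ k

open Classical in
/-- Agent `a` receives `b`, agent `b` receives `d`, and agent `d` receives the better of `a` and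
`c`, leaving the other one to agent `c`. -/
noncomputable def exceptionalAllocation (P : PrefRel n) (a b c d : Fin n) : Fin n → Fin n := fun i =>
  if i = a then b else if i = b then d
  else if i = c then (if P a c then c else a)
  else if i = d then (if P a c then a else c) else i

theorem exceptionalAllocation_bijective (P : PrefRel n) (hnd : [a, b, c, d].Nodup) :
    Function.Bijective (exceptionalAllocation P a b c d) := by
  refine Finite.injective_iff_bijective.1 fun i j hij => ?_
  simp only [exceptionalAllocation] at hij
  grind

open Classical in
/-- Top trading cycles, except for the exceptional profiles. -/
noncomputable def modifiedTTC (a b c d : Fin n) (Pr : Fin n → PrefRel n) : Fin n → Fin n :=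
  if Exceptional Pr a b c d then exceptionalAllocation (Pr d) a b c d
  else @Classical.epsilon _ ⟨id⟩ (isTTC Pr)

theorem modifiedTTC_of_exceptional (h : Exceptional Pr a b c d) :
    modifiedTTC a b c d Pr = exceptionalAllocation (Pr d) a b c d := if_pos h

theorem isTTC_modifiedTTC (hPr : ∀ i, IsStrictTotalOrder (Fin n) (Pr i))
    (h : ¬ Exceptional Pr a b c d) : isTTC Pr (modifiedTTC a b c d Pr) := by
  rw [modifiedTTC, if_neg h]
  exact Classical.epsilon_spec_aux ⟨id⟩ _ (exists_isTTC hPr)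

theorem Exceptional.individuallyRational (h : Exceptional Pr a b c d) (hnd : [a, b, c, d].Nodup)
    (hPr : ∀ i, IsStrictTotalOrder (Fin n) (Pr i)) (hcirc : ∀ i, CircularOn (Pr i) a b c d)
    (i : Fin n) : exceptionalAllocation (Pr d) a b c d i = i ∨
      Pr i (exceptionalAllocation (Pr d) a b c d i) i := by
  have asymm : ∀ i o o', Pr i o o' → ¬ Pr i o' o := fun i _ _ => asymm_of (Pr i)
  have trans : ∀ i o o' o'', Pr i o o' → Pr i o' o'' → Pr i o o'' :=
    fun i _ _ _ => trans_of (Pr i)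
  have htot : ∀ o o', o = o' ∨ Pr d o o' ∨ Pr d o' o := by
    intro o o'
    have := trichotomous_of (Pr d) o o'
    tauto
  have hd := hcirc d
  have := h.top_a.2
  have := h.top_b.2
  have := h.top_d.2
  have := h.pref_c
  simp only [exceptionalAllocation]
  simp only [CircularOn, Ranks] at hd
  grind

theorem Exceptional.eq_of_weakly_improves (h : Exceptional Pr a b c d) (hnd : [a, b, c, d].Nodup)
    (hPr : ∀ i, IsStrictTotalOrder (Fin n) (Pr i)) {y : Fin n → Fin n} (hy : Function.Bijective y)
    (himp : ∀ i, y i = exceptionalAllocation (Pr d) a b c d i ∨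
      Pr i (y i) (exceptionalAllocation (Pr d) a b c d i)) (i : Fin n) :
    y i = exceptionalAllocation (Pr d) a b c d i := by
  classical
  have asymm : ∀ i o o', Pr i o o' → ¬ Pr i o' o := fun i _ _ => asymm_of (Pr i)
  have hout : ∀ k ∉ ({a, b, c, d} : Set (Fin n)), y k = k := by
    intro k hk
    have hk' := himp k
    have := (h.top_self k hk).2 (y k) (Set.mem_univ _)
    simp only [Set.mem_insert_iff, Set.mem_singleton_iff, not_or] at hk
    simp only [exceptionalAllocation] at hk'
    grind
  have hin : ∀ k ∈ ({a, b, c, d} : Set (Fin n)), y k ∈ ({a, b, c, d} : Set (Fin n)) := by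
    intro k hk
    by_contra hyk
    exact hyk ((hy.injective (hout _ hyk)).symm ▸ hk)
  have hinj : ∀ i j, y i = y j → i = j := fun i j hij => hy.injective hij
  have htot := trichotomous_of (Pr d) a c
  have ha := himp a
  have hb := himp b
  have hd := himp d
  have := h.top_a.2
  have := h.top_b.2
  have ina := hin a
  have inb := hin b
  have inc := hin c
  have ind := hin d
  simp only [Set.mem_insert_iff, Set.mem_singleton_iff] at *
  simp only [exceptionalAllocation] at *
  have hya : y a = b := by grind
  have hyb : y b = d := by grind
  have hyd : y d = if Pr d a c then a else c := by grind
  grind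

/-- In the exceptional profiles no agent gains by forcing top trading cycles to be run. -/
theorem Exceptional.no_gain_leaving (h : Exceptional Pr a b c d) (h' : ¬ Exceptional Qr a b c d)
    (hnd : [a, b, c, d].Nodup) (hPr : ∀ i, IsStrictTotalOrder (Fin n) (Pr i))
    (hQr : ∀ i, IsStrictTotalOrder (Fin n) (Qr i)) (hcirc : ∀ i, CircularOn (Pr i) a b c d)
    {y : Fin n → Fin n} (hy : isTTC Qr y) {i : Fin n} (hQ : ∀ j, j ≠ i → Qr j = Pr j) :
    exceptionalAllocation (Pr d) a b c d i = y i ∨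
      Pr i (exceptionalAllocation (Pr d) a b c d i) (y i) := by
  have hne : (a ≠ b ∧ a ≠ c ∧ a ≠ d) ∧ (b ≠ c ∧ b ≠ d) ∧ c ≠ d := by simpa using hnd
  have asymm : ∀ i o o', Pr i o o' → ¬ Pr i o' o := fun i _ _ => asymm_of (Pr i)
  by_cases hi : i ∈ ({a, b, c, d} : Set (Fin n))
  · obtain ⟨r, hr⟩ := hy.exists_roundsOn hQr fun k hk => by
      rw [hQ k (fun hki => hk (hki ▸ hi))]
      exact h.top_self k hk
    have hyi := (hr i hi).1
    rcases hi with hi | hi | hi | hi <;> subst i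
    · have := h.top_a.2 _ hyi
      simp only [exceptionalAllocation]
      grind
    · have := h.top_b.2 _ hyi
      simp only [exceptionalAllocation]
      grind
    · have hswap := hr.swap_of_top hQr (i := b) (j := d)
        (by rw [hQ b hne.2.1.1]; exact h.top_b) (by rw [hQ d hne.2.2.symm]; exact h.top_d)
      have hyb : y c ≠ y b := hy.1.injective.ne hne.2.1.1.symm
      have hyd : y c ≠ y d := hy.1.injective.ne hne.2.2
      have hQc : ¬ Qr c a c := fun hac => h' ⟨by rw [hQ a hne.1.2.1]; exact h.top_a,
        by rw [hQ b hne.2.1.1]; exact h.top_b, hac, by rw [hQ d hne.2.2.symm]; exact h.top_d,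
        fun k hk => by rw [hQ k (fun hkc => hk (by simp [hkc]))]; exact h.top_self k hk⟩
      have := hy.individuallyRational c
      have := h.pref_c
      simp only [exceptionalAllocation]
      simp only [Set.mem_insert_iff, Set.mem_singleton_iff] at hyi
      grind
    · have hyd : y d ≠ b := by
        intro hyd
        have hQd : ¬ top (Qr d) {a, b, c, d} b := fun hb => h' ⟨by rw [hQ a hne.1.2.2]; exact h.top_a,
          by rw [hQ b hne.2.1.2]; exact h.top_b, by rw [hQ c hne.2.2]; exact h.pref_c, hb,
          fun k hk => by rw [hQ k (fun hkd => hk (by simp [hkd]))]; exact h.top_self k hk⟩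
        obtain ⟨t, ht⟩ := exists_top_of_nonempty (Qr d) (S := {a, b, c, d}) ⟨a, by simp⟩
        have hba := hr.le_of_top hQr (i := a) (by simp) (by rw [hQ a hne.1.2.2]; exact h.top_a)
        have hdb := hr.le_of_top hQr (i := b) (by simp) (by rw [hQ b hne.2.1.2]; exact h.top_b)
        have := hr.eq_top_of_round_le hQr (by rw [hQ c hne.2.2]; exact h.pref_c) (by simp) ht
          (hdb.trans hba) hdb le_rfl
        exact hQd (hyd.symm.trans this ▸ ht)
      have := trichotomous_of (Pr d) a c
      have hd := hcirc d
      have htrans : ∀ o o' o'', Pr d o o' → Pr d o' o'' → Pr d o o'' :=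
        fun _ _ _ => trans_of (Pr d)
      have := h.top_d.2
      simp only [exceptionalAllocation]
      simp only [Set.mem_insert_iff, Set.mem_singleton_iff] at hyi this
      simp only [CircularOn, Ranks] at hd
      grind
  · have := (h.top_self i hi).2 (y i) (Set.mem_univ _)
    simp only [Set.mem_insert_iff, Set.mem_singleton_iff, not_or] at hi
    simp only [exceptionalAllocation]
    grind

/-- No agent gains by inducing an exceptional profile by a misreport. -/
theorem Exceptional.no_gain_entering (h : Exceptional Qr a b c d) (h' : ¬ Exceptional Pr a b c d)
    (hnd : [a, b, c, d].Nodup) (hPr : ∀ i, IsStrictTotalOrder (Fin n) (Pr i))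
    (hcirc : ∀ i, CircularOn (Pr i) a b c d)
    (hx : isTTC Pr x) {i : Fin n} (hQ : ∀ j, j ≠ i → Qr j = Pr j) :
    x i = exceptionalAllocation (Qr d) a b c d i ∨
      Pr i (x i) (exceptionalAllocation (Qr d) a b c d i) := by
  have hne : (a ≠ b ∧ a ≠ c ∧ a ≠ d) ∧ (b ≠ c ∧ b ≠ d) ∧ c ≠ d := by simpa using hnd
  by_cases hi : i ∈ ({a, b, c, d} : Set (Fin n))
  · obtain ⟨r, hr⟩ := hx.exists_roundsOn hPr fun k hk => by
      rw [← hQ k (fun hki => hk (hki ▸ hi))]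
      exact h.top_self k hk
    rcases hi with hi | hi | hi | hi <;> subst i
    · have hQb := hQ b hne.1.1.symm
      have hQc := hQ c hne.1.2.1.symm
      have hQd := hQ d hne.1.2.2.symm
      have hswap := hr.swap_of_top hPr (hQb ▸ h.top_b) (hQd ▸ h.top_d)
      have hac : Pr c a c := hQc ▸ h.pref_c
      have hPa : ¬ top (Pr a) {a, b, c, d} b := fun htop =>
        h' ⟨htop, hQb ▸ h.top_b, hac, hQd ▸ h.top_d, fun k hk =>
          hQ k (fun hka => hk (by simp [hka])) ▸ h.top_self k hk⟩
      have hinj : ∀ i j, x i = x j → i = j := fun i j hij => hx.1.injective hij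
      have asymm : ∀ i o o', Pr i o o' → ¬ Pr i o' o := fun i _ _ => asymm_of (Pr i)
      have htrans : ∀ o o' o'', Pr a o o' → Pr a o' o'' → Pr a o o'' :=
        fun _ _ _ => trans_of (Pr a)
      have hcirca := hcirc a
      obtain ⟨hxa, -, hxa'⟩ := hr a (by simp)
      obtain ⟨hxc, -, hxc'⟩ := hr c (by simp)
      have hxa' := hxa' c (by simp)
      have hxc' := hxc' a (by simp)
      have := hx.individuallyRational a
      simp only [exceptionalAllocation]
      simp only [CircularOn, Ranks] at hcirca
      simp only [top, Set.mem_insert_iff, Set.mem_singleton_iff] at hPa hxa hxc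
      grind
    · obtain ⟨t, ht⟩ := exists_top_of_nonempty (Pr b) (S := {a, b, c, d}) ⟨a, by simp⟩
      have := hr.eq_top_of_round_le hPr (hQ c hne.2.1.1.symm ▸ h.pref_c) (by simp) ht
        (hr.le_of_top hPr (by simp) (hQ a hne.1.1 ▸ h.top_a)) le_rfl
        (hr.le_of_top hPr (by simp) (hQ d hne.2.1.2.symm ▸ h.top_d))
      have := ht.2 d (by simp)
      simp only [exceptionalAllocation]
      grind
    · have hPc : ¬ Pr c a c := fun hac =>
        h' ⟨hQ a hne.1.2.1 ▸ h.top_a, hQ b hne.2.1.1 ▸ h.top_b, hac, hQ d hne.2.2.symm ▸ h.top_d,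
          fun k hk => hQ k (fun hkc => hk (by simp [hkc])) ▸ h.top_self k hk⟩
      have := hx.individuallyRational c
      have := trichotomous_of (Pr c) a c
      have htrans : ∀ o o' o'', Pr c o o' → Pr c o' o'' → Pr c o o'' :=
        fun _ _ _ => trans_of (Pr c)
      simp only [exceptionalAllocation]
      grind
    · obtain ⟨t, ht⟩ := exists_top_of_nonempty (Pr d) (S := {a, b, c, d}) ⟨a, by simp⟩
      have hba := hr.le_of_top hPr (by simp) (hQ a hne.1.2.2 ▸ h.top_a)
      have hdb := hr.le_of_top hPr (by simp) (hQ b hne.2.1.2 ▸ h.top_b)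
      have := hr.eq_top_of_round_le hPr (hQ c hne.2.2 ▸ h.pref_c) (by simp) ht
        (hdb.trans hba) hdb le_rfl
      have := ht.2 a (by simp)
      have := ht.2 c (by simp)
      simp only [exceptionalAllocation]
      grind
  · have := hx.individuallyRational i
    simp only [Set.mem_insert_iff, Set.mem_singleton_iff, not_or] at hi
    simpa only [exceptionalAllocation, hi, if_false] using this

theorem modifiedTTC_strategyproof (hnd : [a, b, c, d].Nodup)
    (hPr : ∀ i, IsStrictTotalOrder (Fin n) (Pr i)) (hQr : ∀ i, IsStrictTotalOrder (Fin n) (Qr i))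
    (hcirc : ∀ i, CircularOn (Pr i) a b c d) {i : Fin n} (hQ : ∀ j, j ≠ i → Qr j = Pr j) :
    modifiedTTC a b c d Pr i = modifiedTTC a b c d Qr i ∨
      Pr i (modifiedTTC a b c d Pr i) (modifiedTTC a b c d Qr i) := by
  by_cases h : Exceptional Pr a b c d <;> by_cases h' : Exceptional Qr a b c d
  · rw [modifiedTTC_of_exceptional h, modifiedTTC_of_exceptional h']
    by_cases hid : i = d
    · subst hid
      have := trichotomous_of (Pr i) a c
      simp only [exceptionalAllocation]
      grind
    · rw [hQ d (Ne.symm hid)]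
      exact Or.inl rfl
  · rw [modifiedTTC_of_exceptional h]
    exact h.no_gain_leaving h' hnd hPr hQr hcirc (isTTC_modifiedTTC hQr h') hQ
  · rw [modifiedTTC_of_exceptional h']
    exact h'.no_gain_entering h hnd hPr hcirc (isTTC_modifiedTTC hPr h) hQ
  · exact (isTTC_modifiedTTC hPr h).strategyproof hPr hQ (isTTC_modifiedTTC hQr h')

theorem not_isTTC_of_exceptional (h : Exceptional Pr a b c d) (hnd : [a, b, c, d].Nodup)
    (hPr : ∀ i, IsStrictTotalOrder (Fin n) (Pr i)) :
    ¬ isTTC Pr (exceptionalAllocation (Pr d) a b c d) := by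
  intro hx
  obtain ⟨r, hr⟩ := hx.exists_roundsOn hPr h.top_self
  have := (hr.swap_of_top hPr h.top_b h.top_d).2
  simp only [exceptionalAllocation] at this
  grind

end Mechanism

theorem stmt19 {n : ℕ} [NeZero n] (hn : 4 ≤ n) :
    ∃ φ : Profile n (fun _ => circDomain n) → Fin n → Fin n,
      (∀ P, Function.Bijective (φ P)) ∧ IR φ ∧ ParetoEff φ ∧ SP φ ∧
      ∃ P, ¬ isTTC P.1 (φ P) := by
  obtain ⟨a, ha⟩ : ∃ a : Fin n, a.val = 0 := ⟨⟨0, by omega⟩, rfl⟩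
  obtain ⟨b, hb⟩ : ∃ b : Fin n, b.val = 1 := ⟨⟨1, by omega⟩, rfl⟩
  obtain ⟨c, hc⟩ : ∃ c : Fin n, c.val = 2 := ⟨⟨2, by omega⟩, rfl⟩
  obtain ⟨d, hd⟩ : ∃ d : Fin n, d.val = 3 := ⟨⟨3, by omega⟩, rfl⟩
  have hnd : [a, b, c, d].Nodup := by
    simp only [List.nodup_cons, List.mem_cons, List.not_mem_nil, Fin.ext_iff]
    simp [ha, hb, hc, hd]
  have hord (P : Profile n fun _ => circDomain n) (i : Fin n) : IsStrictTotalOrder (Fin n) (P.1 i) :=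
    isStrictTotalOrder_of_mem_circDomain (P.2 i)
  have hcirc (P : Profile n fun _ => circDomain n) (i : Fin n) : CircularOn (P.1 i) a b c d :=
    circularOn_of_mem_circDomain (P.2 i) (by omega) (by omega) (by omega)
  have hne : (a ≠ b ∧ a ≠ c ∧ a ≠ d) ∧ (b ≠ c ∧ b ≠ d) ∧ c ≠ d := by simpa using hnd
  refine ⟨fun P => modifiedTTC a b c d P.1, fun P => ?_, fun P => ?_, fun P => ?_, fun P Q i hQ => ?_,
    ?_⟩
  · by_cases h : Exceptional P.1 a b c d
    · simpa only [modifiedTTC_of_exceptional h] using exceptionalAllocation_bijective _ hnd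
    · exact (isTTC_modifiedTTC (hord P) h).1
  · by_cases h : Exceptional P.1 a b c d
    · simpa only [modifiedTTC_of_exceptional h] using
        h.individuallyRational hnd (hord P) (hcirc P)
    · exact (isTTC_modifiedTTC (hord P) h).individuallyRational
  · by_cases h : Exceptional P.1 a b c d
    · simpa only [modifiedTTC_of_exceptional h] using
        fun y => h.eq_of_weakly_improves hnd (hord P) (y := y)
    · exact fun y => (isTTC_modifiedTTC (hord P) h).eq_of_weakly_improves (hord P)
  · exact modifiedTTC_strategyproof hnd (hord P) (hord Q) (hcirc P) hQ
  · have htop (k : Fin n) (M : Set (Fin n)) (hk : k ∈ M) : top (cw k) M k := by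
      refine ⟨hk, fun o _ ho => ?_⟩
      have := Fin.val_ne_of_ne ho
      simp only [cw, val_sub_eq_ite]
      split_ifs <;> omega
    let P : Profile n fun _ => circDomain n :=
      ⟨fun i => cw (if i = a then b else if i = b then d else if i = c then a
        else if i = d then b else i), fun i => ⟨_, Or.inl rfl⟩⟩
    have hPa : P.1 a = cw b := by simp [P]
    have hPb : P.1 b = cw d := by simp [P, hne.1.1.symm]
    have hPc : P.1 c = cw a := by simp [P, hne.1.2.1.symm, hne.2.1.1.symm]
    have hPd : P.1 d = cw b := by simp [P, hne.1.2.2.symm, hne.2.1.2.symm, hne.2.2.symm]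
    have h : Exceptional P.1 a b c d := by
      refine ⟨hPa ▸ htop b _ (by simp), hPb ▸ htop d _ (by simp),
        hPc ▸ (htop a {a, c} (by simp)).2 c (by simp) hne.1.2.1.symm, hPd ▸ htop b _ (by simp),
        fun k hk => ?_⟩
      simp only [Set.mem_insert_iff, Set.mem_singleton_iff, not_or] at hk
      simpa [P, hk] using htop k Set.univ (Set.mem_univ k)
    refine ⟨P, ?_⟩
    simpa only [modifiedTTC_of_exceptional h] using not_isTTC_of_exceptional h hnd (hord P)
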